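/- Fix real k₁, k₂ with −1/2 < k₁ < 1/2 and −1/2 < k₂ < 1/2. Then the linear span of the family {φ_{n,l} : n, l ∈ ℕ} is dense in L²(ℝ²; ℂ), and likewise the linear span of {Ψ_{n,l} : n, l ∈ ℕ} is dense in L²(ℝ²; ℂ). -/

import Mathlib

open MeasureTheory

/-- Partial derivative in the `x`-direction of a function on `ℝ²`. -/
noncomputable def pdx (f : ℝ × ℝ → ℂ) : ℝ × ℝ → ℂ := fun p => fderiv ℝ f p (1, 0)

/-- Partial derivative in the `y`-direction of a function on `ℝ²`. -/
noncomputable def pdy (f : ℝ × ℝ → ℂ) : ℝ × ℝ → ℂ := fun p => fderiv ℝ f p (0, 1)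

/-- `B f = (1/√2)(−i ∂ₓ f − ∂_y f + ((i x/2)(1−2k₂) + (y/2)(1+2k₁)) f)`. -/
noncomputable def Bgll (k₁ k₂ : ℝ) (f : ℝ × ℝ → ℂ) : ℝ × ℝ → ℂ := fun p =>
  (Real.sqrt 2 : ℂ)⁻¹ * (-Complex.I * pdx f p - pdy f p +
    ((Complex.I * (p.1 : ℂ) / 2) * (1 - 2 * (k₂ : ℂ)) +
      ((p.2 : ℂ) / 2) * (1 + 2 * (k₁ : ℂ))) * f p)

/-- `B′ f = (1/√2)(−∂ₓ f − i ∂_y f + ((x/2)(1−2k₂) + (i y/2)(1+2k₁)) f)`. -/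
noncomputable def B'gll (k₁ k₂ : ℝ) (f : ℝ × ℝ → ℂ) : ℝ × ℝ → ℂ := fun p =>
  (Real.sqrt 2 : ℂ)⁻¹ * (-pdx f p - Complex.I * pdy f p +
    (((p.1 : ℂ) / 2) * (1 - 2 * (k₂ : ℂ)) +
      (Complex.I * (p.2 : ℂ) / 2) * (1 + 2 * (k₁ : ℂ))) * f p)

/-- `A† f = (1/√2)(−i ∂ₓ f − ∂_y f + ((i x/2)(1+2k₂) + (y/2)(1−2k₁)) f)`. -/
noncomputable def Adag (k₁ k₂ : ℝ) (f : ℝ × ℝ → ℂ) : ℝ × ℝ → ℂ := fun p =>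
  (Real.sqrt 2 : ℂ)⁻¹ * (-Complex.I * pdx f p - pdy f p +
    ((Complex.I * (p.1 : ℂ) / 2) * (1 + 2 * (k₂ : ℂ)) +
      ((p.2 : ℂ) / 2) * (1 - 2 * (k₁ : ℂ))) * f p)

/-- `A′† f = (1/√2)(−∂ₓ f − i ∂_y f + ((x/2)(1+2k₂) + (i y/2)(1−2k₁)) f)`. -/
noncomputable def A'dag (k₁ k₂ : ℝ) (f : ℝ × ℝ → ℂ) : ℝ × ℝ → ℂ := fun p =>
  (Real.sqrt 2 : ℂ)⁻¹ * (-pdx f p - Complex.I * pdy f p +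
    (((p.1 : ℂ) / 2) * (1 + 2 * (k₂ : ℂ)) +
      (Complex.I * (p.2 : ℂ) / 2) * (1 - 2 * (k₁ : ℂ))) * f p)

/-- `φ₀₀(x,y) = (2π)^{−1/2} exp(−(1+2k₂)x²/4 − (1−2k₁)y²/4)`. -/
noncomputable def phi00 (k₁ k₂ : ℝ) : ℝ × ℝ → ℂ := fun p =>
  (Real.sqrt (2 * Real.pi) : ℂ)⁻¹ *
    Complex.exp (-(1 + 2 * (k₂ : ℂ)) * (p.1 : ℂ) ^ 2 / 4 -
      (1 - 2 * (k₁ : ℂ)) * (p.2 : ℂ) ^ 2 / 4)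

/-- `Ψ₀₀(x,y) = (2π)^{−1/2} exp(−(1−2k₂)x²/4 − (1+2k₁)y²/4)`. -/
noncomputable def psi00 (k₁ k₂ : ℝ) : ℝ × ℝ → ℂ := fun p =>
  (Real.sqrt (2 * Real.pi) : ℂ)⁻¹ *
    Complex.exp (-(1 - 2 * (k₂ : ℂ)) * (p.1 : ℂ) ^ 2 / 4 -
      (1 + 2 * (k₁ : ℂ)) * (p.2 : ℂ) ^ 2 / 4)

/-- `φ_{n,l} = (n! l!)^{−1/2} B′ⁿ Bˡ φ₀₀`. -/
noncomputable def phiNL (k₁ k₂ : ℝ) (n l : ℕ) : ℝ × ℝ → ℂ := fun p =>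
  (Real.sqrt (n.factorial * l.factorial) : ℂ)⁻¹ *
    ((B'gll k₁ k₂)^[n] ((Bgll k₁ k₂)^[l] (phi00 k₁ k₂)) p)

/-- `Ψ_{n,l} = (n! l!)^{−1/2} (A′†)ⁿ (A†)ˡ Ψ₀₀`. -/
noncomputable def psiNL (k₁ k₂ : ℝ) (n l : ℕ) : ℝ × ℝ → ℂ := fun p =>
  (Real.sqrt (n.factorial * l.factorial) : ℂ)⁻¹ *
    ((A'dag k₁ k₂)^[n] ((Adag k₁ k₂)^[l] (psi00 k₁ k₂)) p)


section Fourier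

variable {E : Type*} [NormedAddCommGroup E] [NormedSpace ℝ E] [CompleteSpace E]
  [SecondCountableTopology E] [MeasurableSpace E] [BorelSpace E] {μ : Measure E}

/-- A real integrable function whose Fourier transform vanishes is zero almost everywhere. -/
theorem ae_eq_zero_of_integral_cexp_mul_ofReal_eq_zero {h : E → ℝ} (hh : Integrable h μ)
    (h0 : ∀ L : StrongDual ℝ E, ∫ x, Complex.exp (L x * Complex.I) * (h x : ℂ) ∂μ = 0) :
    h =ᵐ[μ] 0 := by
  have := isFiniteMeasure_withDensity_ofReal hh.2
  have := isFiniteMeasure_withDensity_ofReal hh.neg.2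
  have hm : AEMeasurable (fun x => ENNReal.ofReal (h x)) μ := hh.aemeasurable.ennreal_ofReal
  have hm' : AEMeasurable (fun x => ENNReal.ofReal ((-h) x)) μ :=
    hh.neg.aemeasurable.ennreal_ofReal
  have key : μ.withDensity (fun x => ENNReal.ofReal (h x)) =
      μ.withDensity (fun x => ENNReal.ofReal ((-h) x)) := by
    refine Measure.ext_of_charFunDual (funext fun L => ?_)
    rw [charFunDual_apply, charFunDual_apply,
      integral_withDensity_eq_integral_toReal_smul₀ hm (by simp),
      integral_withDensity_eq_integral_toReal_smul₀ hm' (by simp), ← sub_eq_zero,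
      ← integral_sub, ← h0 L]
    · refine integral_congr_ae (.of_forall fun x => ?_)
      have hx : (h x : ℂ) = ((max (h x) 0 : ℝ) : ℂ) - ((max (-h x) 0 : ℝ) : ℂ) := by
        rw [← Complex.ofReal_sub, max_zero_sub_max_neg_zero_eq_self]
      simp only [ENNReal.toReal_ofReal', Pi.neg_apply, Complex.real_smul, hx]
      ring
    · exact (hh.pos_part.ofReal (𝕜 := ℂ)).mul_bdd (c := 1)
        (g := fun x => Complex.exp (L x * Complex.I)) (by fun_prop)
        (.of_forall fun x => (Complex.norm_exp_ofReal_mul_I _).le) |>.congr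
        (.of_forall fun x => by simp [ENNReal.toReal_ofReal'])
    · exact (hh.neg_part.ofReal (𝕜 := ℂ)).mul_bdd (c := 1)
        (g := fun x => Complex.exp (L x * Complex.I)) (by fun_prop)
        (.of_forall fun x => (Complex.norm_exp_ofReal_mul_I _).le) |>.congr
        (.of_forall fun x => by simp [ENNReal.toReal_ofReal'])
  have hae := (withDensity_eq_iff hm hm' hh.lintegral_lt_top.ne).1 key
  filter_upwards [hae] with x hx
  simp only [Pi.neg_apply, Pi.zero_apply] at hx ⊢
  rcases le_total (h x) 0 with h1 | h1
  · rw [ENNReal.ofReal_of_nonpos h1, eq_comm, ENNReal.ofReal_eq_zero] at hx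
    linarith
  · rw [ENNReal.ofReal_of_nonpos (neg_nonpos.2 h1), ENNReal.ofReal_eq_zero] at hx
    linarith

/-- A complex integrable function whose Fourier transform vanishes is zero almost everywhere. -/
theorem ae_eq_zero_of_integral_cexp_mul_eq_zero {h : E → ℂ} (hh : Integrable h μ)
    (h0 : ∀ L : StrongDual ℝ E, ∫ x, Complex.exp (L x * Complex.I) * h x ∂μ = 0) :
    h =ᵐ[μ] 0 := by
  have hint : ∀ L : StrongDual ℝ E,
      Integrable (fun x => Complex.exp (L x * Complex.I) * h x) μ := fun L =>
    hh.bdd_mul (c := 1) (by fun_prop)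
      (.of_forall fun x => (Complex.norm_exp_ofReal_mul_I _).le)
  have hconj : ∀ L : StrongDual ℝ E,
      ∫ x, Complex.exp (L x * Complex.I) * (starRingEnd ℂ) (h x) ∂μ = 0 := fun L => by
    have := congrArg (starRingEnd ℂ) (h0 (-L))
    rw [← integral_conj, map_zero] at this
    rw [← this]
    refine integral_congr_ae (.of_forall fun x => ?_)
    simp [← Complex.exp_conj]
  have hint' : ∀ L : StrongDual ℝ E,
      Integrable (fun x => Complex.exp (L x * Complex.I) * (starRingEnd ℂ) (h x)) μ := fun L =>
    (Complex.conjLIE.integrable_comp_iff.2 hh).bdd_mul (c := 1) (by fun_prop)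
      (.of_forall fun x => (Complex.norm_exp_ofReal_mul_I _).le)
  have hre := ae_eq_zero_of_integral_cexp_mul_ofReal_eq_zero hh.re fun L => by
    calc ∫ x, Complex.exp (L x * Complex.I) * ((h x).re : ℂ) ∂μ
        = ∫ x, (2⁻¹ : ℂ) * (Complex.exp (L x * Complex.I) * h x +
            Complex.exp (L x * Complex.I) * (starRingEnd ℂ) (h x)) ∂μ := by
          refine integral_congr_ae (.of_forall fun x => ?_)
          simp only [Complex.re_eq_add_conj]
          ring
      _ = 0 := by rw [integral_const_mul, integral_add (hint L) (hint' L), h0, hconj]; simp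
  have him := ae_eq_zero_of_integral_cexp_mul_ofReal_eq_zero hh.im fun L => by
    calc ∫ x, Complex.exp (L x * Complex.I) * ((h x).im : ℂ) ∂μ
        = ∫ x, (2 * Complex.I)⁻¹ * (Complex.exp (L x * Complex.I) * h x -
            Complex.exp (L x * Complex.I) * (starRingEnd ℂ) (h x)) ∂μ := by
          refine integral_congr_ae (.of_forall fun x => ?_)
          simp only [Complex.im_eq_sub_conj]
          ring
      _ = 0 := by rw [integral_const_mul, integral_sub (hint L) (hint' L), h0, hconj]; simp
  filter_upwards [hre, him] with x h1 h2
  exact Complex.ext h1 h2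

/-- An exponentially integrable function all of whose moments vanish is zero almost everywhere. -/
theorem ae_eq_zero_of_integral_pow_mul_eq_zero {h : E → ℂ} (hh : Integrable h μ)
    (hexp : ∀ L : StrongDual ℝ E, Integrable (fun x => Real.exp |L x| * ‖h x‖) μ)
    (h0 : ∀ (L : StrongDual ℝ E) (n : ℕ), ∫ x, (L x : ℂ) ^ n * h x ∂μ = 0) :
    h =ᵐ[μ] 0 := by
  refine ae_eq_zero_of_integral_cexp_mul_eq_zero hh fun L => ?_
  have hb : ∀ x, HasSum (fun n : ℕ => |L x| ^ n / n.factorial * ‖h x‖)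
      (Real.exp |L x| * ‖h x‖) := fun x => by
    rw [Real.exp_eq_exp_ℝ]
    exact (NormedSpace.expSeries_div_hasSum_exp (|L x|)).mul_right _
  have hs := hasSum_integral_of_dominated_convergence (μ := μ)
    (F := fun (n : ℕ) x => (L x * Complex.I) ^ n / n.factorial * h x)
    (f := fun x => Complex.exp (L x * Complex.I) * h x)
    (fun n x => |L x| ^ n / n.factorial * ‖h x‖)
    (fun n => AEStronglyMeasurable.mul (by fun_prop) hh.1)
    (fun n => .of_forall fun x => by simp)
    (.of_forall fun x => (hb x).summable)
    ((hexp L).congr (.of_forall fun x => (hb x).tsum_eq.symm))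
    (.of_forall fun x => by
      rw [Complex.exp_eq_exp_ℂ]
      exact (NormedSpace.expSeries_div_hasSum_exp (L x * Complex.I)).mul_right _)
  refine hs.unique ?_
  convert hasSum_zero with n
  calc ∫ x, (L x * Complex.I) ^ n / n.factorial * h x ∂μ
      = ∫ x, Complex.I ^ n / n.factorial * ((L x : ℂ) ^ n * h x) ∂μ := by
        refine integral_congr_ae (.of_forall fun x => ?_)
        simp only [mul_pow]
        ring
    _ = 0 := by rw [integral_const_mul, h0, mul_zero]

end Fourier

section Ladder

variable (k₁ k₂ : ℝ)

/-- The monomial `z ^ a * z̄ ^ b`, with `z = x + i y`, times the Gaussian `φ₀₀`. -/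
noncomputable def gaussMonomial (a b : ℕ) : ℝ × ℝ → ℂ := fun p =>
  ((p.1 : ℂ) + Complex.I * p.2) ^ a * ((p.1 : ℂ) - Complex.I * p.2) ^ b * phi00 k₁ k₂ p

/-- The span of the Gaussian monomials of degree less than `N`. -/
noncomputable def gaussPolynomialsLT (N : ℕ) : Submodule ℂ (ℝ × ℝ → ℂ) :=
  Submodule.span ℂ {h | ∃ a b : ℕ, a + b < N ∧ h = gaussMonomial k₁ k₂ a b}

/-- The span of the family `φ_{n,l}`. -/
noncomputable def phiSpan : Submodule ℂ (ℝ × ℝ → ℂ) :=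
  Submodule.span ℂ {h | ∃ n l : ℕ, h = phiNL k₁ k₂ n l}

theorem gaussMonomial_zero_zero : gaussMonomial k₁ k₂ 0 0 = phi00 k₁ k₂ := by
  ext p
  simp [gaussMonomial]

theorem hasFDerivAt_gaussMonomial (a b : ℕ) (p : ℝ × ℝ) :
    ∃ D : ℝ × ℝ →L[ℝ] ℂ, HasFDerivAt (gaussMonomial k₁ k₂ a b) D p ∧
      D (1, 0) = a * gaussMonomial k₁ k₂ (a - 1) b p + b * gaussMonomial k₁ k₂ a (b - 1) p
        - (1 + 2 * k₂) / 2 * p.1 * gaussMonomial k₁ k₂ a b p ∧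
      D (0, 1) = Complex.I * (a * gaussMonomial k₁ k₂ (a - 1) b p
        - b * gaussMonomial k₁ k₂ a (b - 1) p)
        - (1 - 2 * k₁) / 2 * p.2 * gaussMonomial k₁ k₂ a b p := by
  have h1 : HasFDerivAt (fun q : ℝ × ℝ => (q.1 : ℂ))
      (Complex.ofRealCLM.comp (ContinuousLinearMap.fst ℝ ℝ ℝ)) p :=
    (Complex.ofRealCLM.comp (ContinuousLinearMap.fst ℝ ℝ ℝ)).hasFDerivAt
  have h2 : HasFDerivAt (fun q : ℝ × ℝ => (q.2 : ℂ))
      (Complex.ofRealCLM.comp (ContinuousLinearMap.snd ℝ ℝ ℝ)) p :=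
    (Complex.ofRealCLM.comp (ContinuousLinearMap.snd ℝ ℝ ℝ)).hasFDerivAt
  have hz := (h1.add (h2.const_mul Complex.I)).pow a
  have hw := (h1.sub (h2.const_mul Complex.I)).pow b
  have hg := ((((h1.pow 2).const_mul (-(1 + 2 * (k₂ : ℂ)))).mul_const (4⁻¹ : ℂ)).sub
    (((h2.pow 2).const_mul (1 - 2 * (k₁ : ℂ))).mul_const (4⁻¹ : ℂ))).cexp.const_mul
      (Real.sqrt (2 * Real.pi) : ℂ)⁻¹
  refine ⟨_, (hz.mul hw).mul hg, ?_, ?_⟩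
  all_goals
    simp [gaussMonomial, phi00, div_eq_mul_inv]
    ring

theorem differentiable_gaussMonomial (a b : ℕ) :
    Differentiable ℝ (gaussMonomial k₁ k₂ a b) := fun p =>
  let ⟨_, h, _⟩ := hasFDerivAt_gaussMonomial k₁ k₂ a b p
  h.differentiableAt

theorem B'gll_gaussMonomial (a b : ℕ) :
    B'gll k₁ k₂ (gaussMonomial k₁ k₂ a b) = (Real.sqrt 2 : ℂ)⁻¹ •
      (gaussMonomial k₁ k₂ (a + 1) b - (2 * b : ℂ) • gaussMonomial k₁ k₂ a (b - 1)) := by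
  ext p
  obtain ⟨D, hD, hx, hy⟩ := hasFDerivAt_gaussMonomial k₁ k₂ a b p
  have hs : gaussMonomial k₁ k₂ (a + 1) b p =
      ((p.1 : ℂ) + Complex.I * p.2) * gaussMonomial k₁ k₂ a b p := by
    simp only [gaussMonomial]
    ring
  simp only [B'gll, pdx, pdy, hD.fderiv, hx, hy, Pi.smul_apply, Pi.sub_apply, smul_eq_mul, hs]
  linear_combination (Real.sqrt 2 : ℂ)⁻¹ * (b * gaussMonomial k₁ k₂ a (b - 1) p
    - a * gaussMonomial k₁ k₂ (a - 1) b p) * Complex.I_sq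

theorem Bgll_gaussMonomial (a b : ℕ) :
    Bgll k₁ k₂ (gaussMonomial k₁ k₂ a b) = ((Real.sqrt 2 : ℂ)⁻¹ * Complex.I) •
      (gaussMonomial k₁ k₂ a (b + 1) - (2 * a : ℂ) • gaussMonomial k₁ k₂ (a - 1) b) := by
  ext p
  obtain ⟨D, hD, hx, hy⟩ := hasFDerivAt_gaussMonomial k₁ k₂ a b p
  have hs : gaussMonomial k₁ k₂ a (b + 1) p =
      ((p.1 : ℂ) - Complex.I * p.2) * gaussMonomial k₁ k₂ a b p := by
    simp only [gaussMonomial]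
    ring
  simp only [Bgll, pdx, pdy, hD.fderiv, hx, hy, Pi.smul_apply, Pi.sub_apply, smul_eq_mul, hs]
  linear_combination (Real.sqrt 2 : ℂ)⁻¹ * p.2 * gaussMonomial k₁ k₂ a b p * Complex.I_sq

variable {k₁ k₂}

theorem B'gll_add {f g : ℝ × ℝ → ℂ} (hf : Differentiable ℝ f) (hg : Differentiable ℝ g) :
    B'gll k₁ k₂ (f + g) = B'gll k₁ k₂ f + B'gll k₁ k₂ g := by
  ext p
  simp only [B'gll, pdx, pdy, fderiv_add (hf p) (hg p), Pi.add_apply, add_apply]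
  ring

theorem Bgll_add {f g : ℝ × ℝ → ℂ} (hf : Differentiable ℝ f) (hg : Differentiable ℝ g) :
    Bgll k₁ k₂ (f + g) = Bgll k₁ k₂ f + Bgll k₁ k₂ g := by
  ext p
  simp only [Bgll, pdx, pdy, fderiv_add (hf p) (hg p), Pi.add_apply, add_apply]
  ring

theorem B'gll_smul (c : ℂ) {f : ℝ × ℝ → ℂ} (hf : Differentiable ℝ f) :
    B'gll k₁ k₂ (c • f) = c • B'gll k₁ k₂ f := by
  ext p
  simp only [B'gll, pdx, pdy, fderiv_const_smul (hf p) c, Pi.smul_apply, smul_apply, smul_eq_mul]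
  ring

theorem Bgll_smul (c : ℂ) {f : ℝ × ℝ → ℂ} (hf : Differentiable ℝ f) :
    Bgll k₁ k₂ (c • f) = c • Bgll k₁ k₂ f := by
  ext p
  simp only [Bgll, pdx, pdy, fderiv_const_smul (hf p) c, Pi.smul_apply, smul_apply, smul_eq_mul]
  ring

theorem gaussMonomial_mem {a b N : ℕ} (h : a + b < N) :
    gaussMonomial k₁ k₂ a b ∈ gaussPolynomialsLT k₁ k₂ N :=
  Submodule.subset_span ⟨a, b, h, rfl⟩

theorem gaussPolynomialsLT_mono : Monotone (gaussPolynomialsLT k₁ k₂) := fun _ _ h =>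
  Submodule.span_mono fun _ ⟨a, b, hab, e⟩ => ⟨a, b, hab.trans_le h, e⟩

theorem ladder_mem_gaussPolynomialsLT {N : ℕ} {f : ℝ × ℝ → ℂ}
    (hf : f ∈ gaussPolynomialsLT k₁ k₂ N) :
    Differentiable ℝ f ∧ B'gll k₁ k₂ f ∈ gaussPolynomialsLT k₁ k₂ (N + 1) ∧
      Bgll k₁ k₂ f ∈ gaussPolynomialsLT k₁ k₂ (N + 1) := by
  induction hf using Submodule.span_induction with
  | mem f h =>
    obtain ⟨a, b, hab, rfl⟩ := h
    refine ⟨differentiable_gaussMonomial k₁ k₂ a b, ?_, ?_⟩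
    · rw [B'gll_gaussMonomial]
      exact Submodule.smul_mem _ _ (Submodule.sub_mem _ (gaussMonomial_mem (by lia))
        (Submodule.smul_mem _ _ (gaussMonomial_mem (by lia))))
    · rw [Bgll_gaussMonomial]
      exact Submodule.smul_mem _ _ (Submodule.sub_mem _ (gaussMonomial_mem (by lia))
        (Submodule.smul_mem _ _ (gaussMonomial_mem (by lia))))
  | zero =>
    have hd : Differentiable ℝ (0 : ℝ × ℝ → ℂ) := differentiable_const 0
    have h' := B'gll_smul (k₁ := k₁) (k₂ := k₂) 0 hd
    have h := Bgll_smul (k₁ := k₁) (k₂ := k₂) 0 hd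
    rw [zero_smul, zero_smul] at h h'
    rw [h, h']
    exact ⟨hd, Submodule.zero_mem _, Submodule.zero_mem _⟩
  | add f g _ _ hf hg =>
    rw [B'gll_add hf.1 hg.1, Bgll_add hf.1 hg.1]
    exact ⟨hf.1.add hg.1, Submodule.add_mem _ hf.2.1 hg.2.1, Submodule.add_mem _ hf.2.2 hg.2.2⟩
  | smul c f _ hf =>
    rw [B'gll_smul c hf.1, Bgll_smul c hf.1]
    exact ⟨hf.1.const_smul c, Submodule.smul_mem _ _ hf.2.1, Submodule.smul_mem _ _ hf.2.2⟩

/-- `f` agrees with a nonzero multiple of the monomial of bidegree `(a, b)` up to lower order. -/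
def HasLeadingMonomial (k₁ k₂ : ℝ) (f : ℝ × ℝ → ℂ) (a b : ℕ) : Prop :=
  ∃ c : ℂ, c ≠ 0 ∧ ∃ r ∈ gaussPolynomialsLT k₁ k₂ (a + b), f = c • gaussMonomial k₁ k₂ a b + r

theorem HasLeadingMonomial.B'gll {f : ℝ × ℝ → ℂ} {a b : ℕ} (hf : HasLeadingMonomial k₁ k₂ f a b) :
    HasLeadingMonomial k₁ k₂ (B'gll k₁ k₂ f) (a + 1) b := by
  obtain ⟨c, hc, r, hr, rfl⟩ := hf
  obtain ⟨hd, hr', -⟩ := ladder_mem_gaussPolynomialsLT hr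
  have hm := differentiable_gaussMonomial k₁ k₂ a b
  refine ⟨c * (Real.sqrt 2 : ℂ)⁻¹, mul_ne_zero hc (by simp),
    -(c * (Real.sqrt 2 : ℂ)⁻¹ * (2 * b)) • gaussMonomial k₁ k₂ a (b - 1) + _root_.B'gll k₁ k₂ r,
    Submodule.add_mem _ (Submodule.smul_mem _ _ (gaussMonomial_mem (by lia))) ?_, ?_⟩
  · rwa [Nat.add_right_comm]
  · rw [B'gll_add (hm.const_smul c) hd, B'gll_smul c hm, B'gll_gaussMonomial]
    module

theorem HasLeadingMonomial.Bgll {f : ℝ × ℝ → ℂ} {a b : ℕ} (hf : HasLeadingMonomial k₁ k₂ f a b) :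
    HasLeadingMonomial k₁ k₂ (Bgll k₁ k₂ f) a (b + 1) := by
  obtain ⟨c, hc, r, hr, rfl⟩ := hf
  obtain ⟨hd, -, hr'⟩ := ladder_mem_gaussPolynomialsLT hr
  have hm := differentiable_gaussMonomial k₁ k₂ a b
  refine ⟨c * ((Real.sqrt 2 : ℂ)⁻¹ * Complex.I), mul_ne_zero hc (by simp),
    -(c * ((Real.sqrt 2 : ℂ)⁻¹ * Complex.I) * (2 * a)) • gaussMonomial k₁ k₂ (a - 1) b +
      _root_.Bgll k₁ k₂ r,
    Submodule.add_mem _ (Submodule.smul_mem _ _ (gaussMonomial_mem (by lia))) hr', ?_⟩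
  rw [Bgll_add (hm.const_smul c) hd, Bgll_smul c hm, Bgll_gaussMonomial]
  module

theorem hasLeadingMonomial_iterate (n l : ℕ) :
    HasLeadingMonomial k₁ k₂ ((B'gll k₁ k₂)^[n] ((Bgll k₁ k₂)^[l] (phi00 k₁ k₂))) n l := by
  induction n with
  | zero =>
    induction l with
    | zero => exact ⟨1, one_ne_zero, 0, Submodule.zero_mem _, by simp [gaussMonomial_zero_zero]⟩
    | succ l ih => simpa only [Function.iterate_succ_apply'] using! ih.Bgll
  | succ n ih => simpa only [Function.iterate_succ_apply'] using ih.B'gll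

theorem gaussPolynomialsLT_le_phiSpan (N : ℕ) :
    gaussPolynomialsLT k₁ k₂ N ≤ phiSpan k₁ k₂ := by
  induction N with
  | zero => exact Submodule.span_le.2 fun _ ⟨a, b, h, _⟩ => absurd h (Nat.not_lt_zero _)
  | succ N ih =>
    refine Submodule.span_le.2 ?_
    rintro _ ⟨a, b, hab, rfl⟩
    obtain ⟨c, hc, r, hr, h⟩ := hasLeadingMonomial_iterate (k₁ := k₁) (k₂ := k₂) a b
    have hphi : phiNL k₁ k₂ a b = (Real.sqrt (a.factorial * b.factorial) : ℂ)⁻¹ •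
        (B'gll k₁ k₂)^[a] ((Bgll k₁ k₂)^[b] (phi00 k₁ k₂)) := rfl
    have hs : (Real.sqrt (a.factorial * b.factorial) : ℂ) ≠ 0 := by
      rw [Complex.ofReal_ne_zero]
      positivity
    have he : gaussMonomial k₁ k₂ a b = c⁻¹ •
        ((Real.sqrt (a.factorial * b.factorial) : ℂ) • phiNL k₁ k₂ a b - r) := by
      rw [hphi, smul_inv_smul₀ hs, h, add_sub_cancel_right, inv_smul_smul₀ hc]
    rw [SetLike.mem_coe, he]
    exact Submodule.smul_mem _ _ (Submodule.sub_mem _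
      (Submodule.smul_mem _ _ (Submodule.subset_span ⟨a, b, rfl⟩))
      (ih (gaussPolynomialsLT_mono (Nat.lt_succ_iff.1 hab) hr)))

theorem linear_mul_mem_gaussPolynomialsLT (s t : ℝ) {N : ℕ} {f : ℝ × ℝ → ℂ}
    (hf : f ∈ gaussPolynomialsLT k₁ k₂ N) :
    (fun p : ℝ × ℝ => ((s * p.1 + t * p.2 : ℝ) : ℂ) * f p) ∈
      gaussPolynomialsLT k₁ k₂ (N + 1) := by
  induction hf using Submodule.span_induction with
  | mem f h =>
    obtain ⟨a, b, hab, rfl⟩ := h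
    have he : (fun p : ℝ × ℝ => ((s * p.1 + t * p.2 : ℝ) : ℂ) * gaussMonomial k₁ k₂ a b p) =
        ((s - Complex.I * t) / 2) • gaussMonomial k₁ k₂ (a + 1) b +
        ((s + Complex.I * t) / 2) • gaussMonomial k₁ k₂ a (b + 1) := by
      ext p
      simp only [gaussMonomial, Pi.add_apply, Pi.smul_apply, smul_eq_mul, pow_succ]
      push_cast
      linear_combination (t * p.2 * (((p.1 : ℂ) + Complex.I * p.2) ^ a *
        ((p.1 : ℂ) - Complex.I * p.2) ^ b * phi00 k₁ k₂ p)) * Complex.I_sq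
    rw [he]
    exact Submodule.add_mem _ (Submodule.smul_mem _ _ (gaussMonomial_mem (by lia)))
      (Submodule.smul_mem _ _ (gaussMonomial_mem (by lia)))
  | zero =>
    simp only [Pi.zero_apply, mul_zero]
    exact Submodule.zero_mem _
  | add f g _ _ hf hg =>
    convert Submodule.add_mem _ hf hg using 1
    ext p
    simp [mul_add]
  | smul c f _ hf =>
    convert Submodule.smul_mem _ c hf using 1
    ext p
    simp only [Pi.smul_apply, smul_eq_mul]
    ring

theorem linear_pow_mul_phi00_mem_phiSpan (s t : ℝ) (n : ℕ) :
    (fun p : ℝ × ℝ => ((s * p.1 + t * p.2 : ℝ) : ℂ) ^ n * phi00 k₁ k₂ p) ∈ phiSpan k₁ k₂ := by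
  refine gaussPolynomialsLT_le_phiSpan (n + 1) ?_
  induction n with
  | zero =>
    simpa [gaussMonomial_zero_zero] using
      gaussMonomial_mem (k₁ := k₁) (k₂ := k₂) (a := 0) (b := 0) one_pos
  | succ n ih =>
    convert linear_mul_mem_gaussPolynomialsLT s t ih using 1
    ext p
    ring

end Ladder

section Density

variable {k₁ k₂ : ℝ}

theorem phi00_eq_ofReal (p : ℝ × ℝ) :
    phi00 k₁ k₂ p = (((Real.sqrt (2 * Real.pi))⁻¹ *
      Real.exp (-(1 + 2 * k₂) * p.1 ^ 2 / 4 - (1 - 2 * k₁) * p.2 ^ 2 / 4) : ℝ) : ℂ) := by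
  simp [phi00]

theorem continuous_phi00 : Continuous (phi00 k₁ k₂) := by
  unfold phi00
  fun_prop

theorem phi00_ne_zero (p : ℝ × ℝ) : phi00 k₁ k₂ p ≠ 0 := by
  rw [phi00_eq_ofReal, Complex.ofReal_ne_zero]
  positivity

theorem abs_mul_le_of_pos {a : ℝ} (ha : 0 < a) (s x : ℝ) :
    |s * x| ≤ a * x ^ 2 + s ^ 2 / (4 * a) := by
  have h : a * x ^ 2 + s ^ 2 / (4 * a) - |s * x| = a * (|x| - |s| / (2 * a)) ^ 2 := by
    rw [abs_mul, ← sq_abs x, ← sq_abs s]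
    field_simp
    ring
  nlinarith [mul_nonneg ha.le (sq_nonneg (|x| - |s| / (2 * a)))]

theorem memLp_exp_neg_sq {a b : ℝ} (ha : 0 < a) (hb : 0 < b) :
    MemLp (fun p : ℝ × ℝ => Real.exp (-a * p.1 ^ 2 - b * p.2 ^ 2)) 2 volume := by
  rw [memLp_two_iff_integrable_sq (by fun_prop)]
  refine ((integrable_exp_neg_mul_sq (b := 2 * a) (by positivity)).mul_prod
    (integrable_exp_neg_mul_sq (b := 2 * b) (by positivity))).congr (.of_forall fun p => ?_)
  simp only
  rw [← Real.exp_add, ← Real.exp_nat_mul]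
  congr 1
  push_cast
  ring

theorem memLp_exp_abs_mul_phi00 (hk₁ : k₁ < 1 / 2) (hk₂ : -1 / 2 < k₂) (s t : ℝ) :
    MemLp (fun p : ℝ × ℝ => Real.exp |s * p.1 + t * p.2| * ‖phi00 k₁ k₂ p‖) 2 volume := by
  have ha : 0 < (1 + 2 * k₂) / 8 := by linarith
  have hb : 0 < (1 - 2 * k₁) / 8 := by linarith
  refine ((memLp_exp_neg_sq ha hb).const_mul ((Real.sqrt (2 * Real.pi))⁻¹ *
    Real.exp (s ^ 2 / (4 * ((1 + 2 * k₂) / 8)) + t ^ 2 / (4 * ((1 - 2 * k₁) / 8))))).mono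
    (Continuous.aestronglyMeasurable ?_) (.of_forall fun p => ?_)
  · have := continuous_phi00 (k₁ := k₁) (k₂ := k₂)
    fun_prop
  · have h1 := abs_mul_le_of_pos ha s p.1
    have h2 := abs_mul_le_of_pos hb t p.2
    have h3 := abs_add_le (s * p.1) (t * p.2)
    rw [phi00_eq_ofReal, Complex.norm_real, Real.norm_of_nonneg (by positivity),
      Real.norm_of_nonneg (by positivity), Real.norm_of_nonneg (by positivity), mul_left_comm,
      mul_assoc, ← Real.exp_add, ← Real.exp_add]
    refine mul_le_mul_of_nonneg_left (Real.exp_le_exp.2 ?_) (by positivity)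
    linarith

theorem memLp_linear_pow_mul_phi00 (hk₁ : k₁ < 1 / 2) (hk₂ : -1 / 2 < k₂) (s t : ℝ) (n : ℕ) :
    MemLp (fun p : ℝ × ℝ => ((s * p.1 + t * p.2 : ℝ) : ℂ) ^ n * phi00 k₁ k₂ p) 2 volume := by
  refine ((memLp_exp_abs_mul_phi00 hk₁ hk₂ s t).const_mul (n.factorial : ℝ)).mono
    (Continuous.aestronglyMeasurable ?_) (.of_forall fun p => ?_)
  · have := continuous_phi00 (k₁ := k₁) (k₂ := k₂)
    fun_prop
  · have h := Real.pow_div_factorial_le_exp |s * p.1 + t * p.2| (abs_nonneg _) n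
    rw [div_le_iff₀ (by positivity)] at h
    rw [norm_mul, norm_pow, Complex.norm_real, Real.norm_eq_abs, Real.norm_of_nonneg (by positivity),
      ← mul_assoc, mul_comm (n.factorial : ℝ)]
    gcongr

theorem dense_setOf_ae_eq_mem_phiSpan (hk₁ : k₁ < 1 / 2) (hk₂ : -1 / 2 < k₂) :
    Dense {F : Lp ℂ 2 (volume : Measure (ℝ × ℝ)) |
      ∃ g ∈ phiSpan k₁ k₂, (F : ℝ × ℝ → ℂ) =ᵐ[volume] g} := by
  let K : Submodule ℂ (Lp ℂ 2 (volume : Measure (ℝ × ℝ))) :=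
    { carrier := {F | ∃ g ∈ phiSpan k₁ k₂, (F : ℝ × ℝ → ℂ) =ᵐ[volume] g}
      add_mem' := fun {F G} ⟨f, hf, hF⟩ ⟨g, hg, hG⟩ =>
        ⟨f + g, Submodule.add_mem _ hf hg, (Lp.coeFn_add F G).trans (hF.add hG)⟩
      zero_mem' := ⟨0, Submodule.zero_mem _, Lp.coeFn_zero _ _ _⟩
      smul_mem' := fun c F ⟨f, hf, hF⟩ =>
        ⟨c • f, Submodule.smul_mem _ c hf, (Lp.coeFn_smul c F).trans (hF.const_smul c)⟩ }
  change Dense (K : Set (Lp ℂ 2 (volume : Measure (ℝ × ℝ))))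
  rw [Submodule.dense_iff_topologicalClosure_eq_top, Submodule.topologicalClosure_eq_top_iff,
    Submodule.eq_bot_iff]
  intro F hF
  have hL : ∀ (L : StrongDual ℝ (ℝ × ℝ)) (p : ℝ × ℝ),
      L p = L (1, 0) * p.1 + L (0, 1) * p.2 := fun L p => by
    conv_lhs => rw [show p = p.1 • ((1, 0) : ℝ × ℝ) + p.2 • ((0, 1) : ℝ × ℝ) by ext <;> simp]
    rw [map_add, map_smul, map_smul, smul_eq_mul, smul_eq_mul, mul_comm, mul_comm p.2]
  have hexp : ∀ L : StrongDual ℝ (ℝ × ℝ),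
      Integrable (fun p => Real.exp |L p| * ‖phi00 k₁ k₂ p * F p‖) volume := fun L => by
    convert (memLp_exp_abs_mul_phi00 hk₁ hk₂ (L (1, 0)) (L (0, 1))).integrable_mul
      (Lp.memLp F).norm using 2 with p
    rw [hL, norm_mul, Pi.mul_apply, mul_assoc]
  have hmeas : AEStronglyMeasurable (fun p => phi00 k₁ k₂ p * F p) volume :=
    continuous_phi00.aestronglyMeasurable.mul (Lp.aestronglyMeasurable F)
  have hzero := ae_eq_zero_of_integral_pow_mul_eq_zero (μ := (volume : Measure (ℝ × ℝ)))
    (h := fun p => phi00 k₁ k₂ p * F p)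
    ((integrable_norm_iff hmeas).1 (by simpa using hexp 0)) hexp fun L n => by
      have hg := memLp_linear_pow_mul_phi00 hk₁ hk₂ (L (1, 0)) (L (0, 1)) n
      have hK : hg.toLp _ ∈ K := ⟨_, linear_pow_mul_phi00_mem_phiSpan _ _ n, hg.coeFn_toLp⟩
      rw [← (Submodule.mem_orthogonal K F).1 hF _ hK, L2.inner_def]
      refine integral_congr_ae ?_
      filter_upwards [hg.coeFn_toLp] with p hp
      rw [hp, hL, phi00_eq_ofReal]
      simp only [RCLike.inner_apply, map_mul, map_pow, Complex.conj_ofReal]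
      ring
  refine Lp.ext ?_
  filter_upwards [hzero, Lp.coeFn_zero ℂ 2 (volume : Measure (ℝ × ℝ))] with p hp h0
  rw [h0]
  exact (mul_eq_zero.1 hp).resolve_left (phi00_ne_zero p)

end Density

theorem psiNL_eq_phiNL_neg (k₁ k₂ : ℝ) (n l : ℕ) :
    psiNL k₁ k₂ n l = phiNL (-k₁) (-k₂) n l := by
  have hA : Adag k₁ k₂ = Bgll (-k₁) (-k₂) := by
    funext f p
    simp [Adag, Bgll, ← sub_eq_add_neg]
  have hA' : A'dag k₁ k₂ = B'gll (-k₁) (-k₂) := by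
    funext f p
    simp [A'dag, B'gll, ← sub_eq_add_neg]
  have h00 : psi00 k₁ k₂ = phi00 (-k₁) (-k₂) := by
    funext p
    simp [psi00, phi00, ← sub_eq_add_neg]
  unfold psiNL phiNL
  rw [hA, hA', h00]

theorem statement9 (k₁ k₂ : ℝ)
    (hk₁ : -1/2 < k₁ ∧ k₁ < 1/2) (hk₂ : -1/2 < k₂ ∧ k₂ < 1/2) :
    Dense {F : Lp ℂ 2 (volume : Measure (ℝ × ℝ)) |
      ∃ g ∈ Submodule.span ℂ {h : ℝ × ℝ → ℂ | ∃ n l : ℕ, h = phiNL k₁ k₂ n l},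
        (F : ℝ × ℝ → ℂ) =ᵐ[volume] g} ∧
    Dense {F : Lp ℂ 2 (volume : Measure (ℝ × ℝ)) |
      ∃ g ∈ Submodule.span ℂ {h : ℝ × ℝ → ℂ | ∃ n l : ℕ, h = psiNL k₁ k₂ n l},
        (F : ℝ × ℝ → ℂ) =ᵐ[volume] g} := by
  refine ⟨dense_setOf_ae_eq_mem_phiSpan hk₁.2 hk₂.1, ?_⟩
  simp only [psiNL_eq_phiNL_neg]
  exact dense_setOf_ae_eq_mem_phiSpan (by linarith [hk₁.1]) (by linarith [hk₂.2])
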